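/- Let N, k, ℓ, n be integers with 0 ≤ n ≤ ℓ ≤ N and 0 ≤ k − n ≤ N − ℓ, and set M = N − k − ℓ + n. Then in the field ℚ(q,t): Σ_{m'=0}^{M} q^{-m'} · t^{-m'(M−m')} · [M choose m']_t / (t^{k−N+1}q^{-1};t)_{m'+ℓ−n} = (1/(t^{k−N+1}q^{-1};t)_{ℓ−n}) · Σ_{j=0}^{M} (−1)^j · t^{j(j−1)/2} · (t^{k−N+ℓ−n};t)_j · (t/q)^j / ((t;t)_j · (t^{k−N+ℓ−n+1}q^{-1};t)_j). -/

import Mathlib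

/-!
Statement 3: with M = N − k − ℓ + n,
  ∑_{m'=0}^{M} q^{-m'} t^{-m'(M−m')} [M choose m']_t / (t^{k−N+1}q^{-1};t)_{m'+ℓ−n}
    = (1/(t^{k−N+1}q^{-1};t)_{ℓ−n}) ·
        ∑_{j=0}^{M} (−1)^j t^{j(j−1)/2} (t^{k−N+ℓ−n};t)_j (t/q)^j
          / ((t;t)_j (t^{k−N+ℓ−n+1}q^{-1};t)_j)
in the field ℚ(q,t).
-/

open Finset MvPolynomial

noncomputable section

/-- The field ℚ(q,t): fraction field of ℚ[q,t] (variables indexed by `Bool`). -/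
abbrev Fqt : Type := FractionRing (MvPolynomial Bool ℚ)

/-- The indeterminate q. -/
def qF : Fqt := algebraMap (MvPolynomial Bool ℚ) Fqt (X true)

/-- The indeterminate t. -/
def tF : Fqt := algebraMap (MvPolynomial Bool ℚ) Fqt (X false)

/-- The q-Pochhammer symbol (a;b)_n = ∏_{i=0}^{n-1} (1 - a·bⁱ). -/
def poch (a b : Fqt) (n : ℕ) : Fqt := ∏ i ∈ Finset.range n, (1 - a * b ^ i)

/-- The t-binomial coefficient [n choose k]_t = (t;t)_n / ((t;t)_k (t;t)_{n−k}). -/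
def tbinom (n k : ℕ) : Fqt := poch tF tF n / (poch tF tF k * poch tF tF (n - k))

theorem tF_pow_sub_ne_zero (i : ℕ) : 1 - tF * tF ^ i ≠ 0 := by
  intro h
  have h₁ : (X false : MvPolynomial Bool ℚ) ^ (i + 1) = 1 := by
    apply IsFractionRing.injective (MvPolynomial Bool ℚ) Fqt
    rw [map_pow, map_one, pow_succ']
    exact (sub_eq_zero.mp h).symm
  simpa using congrArg (eval fun _ => (0 : ℚ)) h₁

theorem tF_ne_zero : tF ≠ 0 := by
  intro h
  have h₁ : (X false : MvPolynomial Bool ℚ) = 0 := by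
    apply IsFractionRing.injective (MvPolynomial Bool ℚ) Fqt
    rw [map_zero]
    exact h
  exact X_ne_zero false h₁

theorem poch_tF_ne_zero (n : ℕ) : poch tF tF n ≠ 0 :=
  Finset.prod_ne_zero_iff.mpr fun i _ => tF_pow_sub_ne_zero i

theorem poch_succ (a b : Fqt) (n : ℕ) : poch a b (n + 1) = poch a b n * (1 - a * b ^ n) :=
  Finset.prod_range_succ _ _

theorem poch_add (a b : Fqt) (m n : ℕ) :
    poch a b (m + n) = poch a b m * poch (a * b ^ m) b n := by
  simp only [poch, Finset.prod_range_add, pow_add, mul_assoc]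

/-- Reversal of a Pochhammer symbol with base point a negative power of `t`. -/
theorem poch_inv_pow_mul (M j : ℕ) (hj : j ≤ M) :
    poch (tF ^ M)⁻¹ tF j * poch tF tF (M - j) * tF ^ (M * j) =
      (-1) ^ j * tF ^ (j * (j - 1) / 2) * poch tF tF M := by
  have ht := tF_ne_zero
  rw [← Nat.choose_two_right]
  induction j with
  | zero => simp [poch]
  | succ j ih =>
    obtain ⟨r, rfl⟩ := Nat.exists_eq_add_of_lt hj
    specialize ih (by omega)
    rw [show j + r + 1 - j = r + 1 by omega, poch_succ tF] at ih
    rw [show j + r + 1 - (j + 1) = r by omega, poch_succ, Nat.choose_succ_succ' j 1,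
      Nat.choose_one_right, pow_add tF j, mul_add_one, pow_add tF _ (j + r + 1), pow_succ (-1 : Fqt)]
    have h : (1 - (tF ^ (j + r + 1))⁻¹ * tF ^ j) * tF ^ (j + r + 1) =
        -tF ^ j * (1 - tF * tF ^ r) := by
      field_simp
      ring
    linear_combination (poch (tF ^ (j + r + 1))⁻¹ tF j * poch tF tF r *
      tF ^ ((j + r + 1) * j)) * h - tF ^ j * ih

theorem tbinom_eq_poch_inv_pow (M j : ℕ) (hj : j ≤ M) :
    tF⁻¹ ^ (j * (M - j)) * tbinom M j =
      (-1) ^ j * tF ^ (j * (j - 1) / 2) * poch (tF ^ M)⁻¹ tF j * tF ^ j / poch tF tF j := by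
  have ht := tF_ne_zero
  have h := poch_inv_pow_mul M j hj
  have hc : tF ^ (j * (j - 1) / 2) * tF ^ (j * (j - 1) / 2) * tF ^ j * tF ^ (j * (M - j)) =
      tF ^ (M * j) := by
    rw [← pow_add, ← pow_add, ← pow_add]
    congr 1
    have h₂ : j * (j - 1) / 2 + j * (j - 1) / 2 = j * (j - 1) := by
      have := Nat.div_mul_cancel (Nat.even_mul_pred_self j).two_dvd
      omega
    rw [h₂]
    obtain ⟨r, rfl⟩ := Nat.exists_eq_add_of_le hj
    cases j with
    | zero => simp
    | succ i => simp only [Nat.add_sub_cancel, Nat.add_sub_cancel_left]; ring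
  have hs : (-1 : Fqt) ^ j * (-1) ^ j = 1 := by rw [← mul_pow]; simp
  have h₁ := poch_tF_ne_zero j
  have h₂ := poch_tF_ne_zero (M - j)
  have hc₀ : tF ^ (j * (j - 1) / 2) ≠ 0 := pow_ne_zero _ ht
  rw [tbinom, inv_pow]
  generalize poch (tF ^ M)⁻¹ tF j = p at *
  generalize tF ^ (j * (j - 1) / 2) = c at *
  field_simp
  apply mul_left_cancel₀ hc₀
  apply mul_left_cancel₀ (left_ne_zero_of_mul_eq_one hs)
  linear_combination -h - p * poch tF tF (M - j) * hc -
    (p * poch tF tF (M - j) * c * c * tF ^ j * tF ^ (j * (M - j))) * hs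

theorem stmt3 (N k ℓ n : ℕ) (h1 : n ≤ ℓ) (h2 : ℓ ≤ N) (h3 : n ≤ k) (h4 : k - n ≤ N - ℓ) :
    ∑ m' ∈ Finset.range (N + n - k - ℓ + 1),
      qF⁻¹ ^ m' * tF⁻¹ ^ (m' * (N + n - k - ℓ - m')) * tbinom (N + n - k - ℓ) m' /
        poch (tF ^ ((k : ℤ) - N + 1) * qF⁻¹) tF (m' + (ℓ - n))
    = (poch (tF ^ ((k : ℤ) - N + 1) * qF⁻¹) tF (ℓ - n))⁻¹ *
        ∑ j ∈ Finset.range (N + n - k - ℓ + 1),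
          (-1 : Fqt) ^ j * tF ^ (j * (j - 1) / 2) *
              poch (tF ^ ((k : ℤ) - N + ℓ - n)) tF j * (tF / qF) ^ j /
            (poch tF tF j * poch (tF ^ ((k : ℤ) - N + ℓ - n + 1) * qF⁻¹) tF j) := by
  obtain ⟨L, rfl⟩ := Nat.exists_eq_add_of_le h1
  obtain ⟨K, rfl⟩ := Nat.exists_eq_add_of_le h3
  obtain ⟨M, rfl⟩ : ∃ M, N = n + L + K + M := ⟨N - (n + L + K), by omega⟩
  have ht := tF_ne_zero
  have hM : n + L + K + M + n - (n + K) - (n + L) = M := by omega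
  have hb : tF ^ (((n + K : ℕ) : ℤ) - (n + L + K + M : ℕ) + 1) * qF⁻¹ * tF ^ L =
      tF ^ (((n + K : ℕ) : ℤ) - (n + L + K + M : ℕ) + (n + L : ℕ) - n + 1) * qF⁻¹ := by
    rw [mul_right_comm, ← zpow_natCast tF L, ← zpow_add₀ ht]
    congr 2
    push_cast
    ring
  have ha : tF ^ (((n + K : ℕ) : ℤ) - (n + L + K + M : ℕ) + (n + L : ℕ) - n) = (tF ^ M)⁻¹ := by
    rw [← zpow_natCast, ← zpow_neg]
    congr 1
    push_cast
    ring
  rw [hM, Nat.add_sub_cancel_left, Finset.mul_sum]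
  refine Finset.sum_congr rfl fun j hj => ?_
  rw [add_comm j L, poch_add, hb, ha, mul_assoc,
    tbinom_eq_poch_inv_pow M j (Nat.lt_succ_iff.mp (Finset.mem_range.mp hj))]
  simp only [div_eq_mul_inv, mul_inv, mul_pow]
  ring

end
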